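/- Let C = aC_a ⊕ bC_b be a linear code of length n over H_32, where C_a is a binary linear code and C_b a ternary linear code. Then C is LCD (i.e. C ∩ C^⊥ = {0}) if and only if C_a = {0} and C_b is an LCD ternary code; moreover, in that case C is nice. -/

import Mathlib

/-!
Common setup: the non-unital rings `H₂₃` and `H₃₂` of order 6, whose common
additive group is `ZMod 2 × ZMod 3`, and codes over them.
-/

/-- The common additive group of the rings `H₂₃` and `H₃₂`. -/
abbrev Hring : Type := ZMod 2 × ZMod 3

/-- The element `a = (1,0)` of `H`. -/
def aH : Hring := (1, 0)

/-- The element `b = (0,1)` of `H`. -/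
def bH : Hring := (0, 1)

/-- Multiplication of the non-unital ring `H₂₃`: `(x₁,y₁)·(x₂,y₂) = (x₁x₂, 0)`. -/
def mul23 (u v : Hring) : Hring := (u.1 * v.1, 0)

/-- Multiplication of the non-unital ring `H₃₂`: `(x₁,y₁)·(x₂,y₂) = (0, y₁y₂)`. -/
def mul32 (u v : Hring) : Hring := (0, u.2 * v.2)

/-- The vector `a·x` associated with a binary vector `x`:
`(a·x)_j = a` if `x_j = 1` and `0` otherwise, i.e. `(a·x)_j = (x_j, 0)`. -/
def aVec {n : ℕ} (x : Fin n → ZMod 2) : Fin n → Hring := fun j => (x j, 0)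

/-- The vector `b·y` associated with a ternary vector `y`:
`(b·y)_j = 0, b, 2b` according as `y_j = 0, 1, 2`, i.e. `(b·y)_j = (0, y_j)`. -/
def bVec {n : ℕ} (y : Fin n → ZMod 3) : Fin n → Hring := fun j => (0, y j)

/-- The code `a C_a ⊕ b C_b = {a·x + b·y : x ∈ C_a, y ∈ C_b}` over `H`. -/
def combCode {n : ℕ} (Ca : Set (Fin n → ZMod 2)) (Cb : Set (Fin n → ZMod 3)) :
    Set (Fin n → Hring) :=
  { c | ∃ x ∈ Ca, ∃ y ∈ Cb, c = aVec x + bVec y }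

/-- Inner product on `H^n` with respect to the multiplication `mul`. -/
def innerH {n : ℕ} (mul : Hring → Hring → Hring) (x y : Fin n → Hring) : Hring :=
  ∑ i, mul (x i) (y i)

/-- Standard inner product on `F^n`. -/
def innerF {F : Type*} [CommRing F] {n : ℕ} (x y : Fin n → F) : F :=
  ∑ i, x i * y i

/-- Dual of a code in `H^n` with respect to the multiplication `mul`. -/
def dualH {n : ℕ} (mul : Hring → Hring → Hring) (C : Set (Fin n → Hring)) :
    Set (Fin n → Hring) :=
  { y | ∀ x ∈ C, innerH mul x y = 0 }

/-- Dual of a code in `F^n` with respect to the standard inner product. -/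
def dualF {F : Type*} [CommRing F] {n : ℕ} (C : Set (Fin n → F)) : Set (Fin n → F) :=
  { y | ∀ x ∈ C, innerF x y = 0 }

/-- A linear code over `(H, mul)`: a nonempty subset of `H^n` closed under
componentwise addition and under (componentwise) multiplication by each ring element. -/
def IsLinearCode {n : ℕ} (mul : Hring → Hring → Hring) (C : Set (Fin n → Hring)) : Prop :=
  C.Nonempty ∧ (∀ u ∈ C, ∀ v ∈ C, u + v ∈ C) ∧
    ∀ r : Hring, ∀ u ∈ C, (fun i => mul r (u i)) ∈ C

/-- Self-orthogonality of a code in `H^n`. -/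
def SelfOrthH {n : ℕ} (mul : Hring → Hring → Hring) (C : Set (Fin n → Hring)) : Prop :=
  ∀ x ∈ C, ∀ y ∈ C, innerH mul x y = 0

/-- Self-orthogonality of a code over a finite field. -/
def SelfOrthF {F : Type*} [CommRing F] {n : ℕ} (C : Set (Fin n → F)) : Prop :=
  ∀ x ∈ C, ∀ y ∈ C, innerF x y = 0

/-- A quasi self-dual (QSD) code: self-orthogonal with `|C| = 6^(n/2)`. -/
def QSD {n : ℕ} (mul : Hring → Hring → Hring) (C : Set (Fin n → Hring)) : Prop :=
  SelfOrthH mul C ∧ (Nat.card C : ℝ) = (6 : ℝ) ^ ((n : ℝ) / 2)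

/-- Hamming weight: the number of nonzero coordinates. -/
def wt {β : Type*} [Zero β] [DecidableEq β] {n : ℕ} (v : Fin n → β) : ℕ :=
  (Finset.univ.filter (fun i => v i ≠ 0)).card

/-- `d` is the minimum distance of the code `C`: `d` is the least Hamming weight of a
nonzero codeword. -/
def IsMinDist {β : Type*} [Zero β] [DecidableEq β] {n : ℕ}
    (C : Set (Fin n → β)) (d : ℕ) : Prop :=
  (∃ v ∈ C, v ≠ 0 ∧ wt v = d) ∧ ∀ v ∈ C, v ≠ 0 → d ≤ wt v

/-- A code is cyclic if it is closed under the cyclic shift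
`(c₁, …, c_n) ↦ (c_n, c₁, …, c_{n-1})`. -/
def IsCyclicCode {β : Type*} {n : ℕ} (C : Set (Fin n → β)) : Prop :=
  ∀ c ∈ C, (fun i : Fin n => c ((finRotate n).symm i)) ∈ C

/-- The linear code over `(H, mul)` generated by a set `S` of vectors: the smallest
linear code containing `S`. -/
def genCode {n : ℕ} (mul : Hring → Hring → Hring) (S : Set (Fin n → Hring)) :
    Set (Fin n → Hring) :=
  ⋂₀ { C | IsLinearCode mul C ∧ S ⊆ C }

theorem card_preimage_prod {α β γ : Type*} (e : α ≃ β × γ) (s : Set β) (t : Set γ) :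
    Nat.card (e ⁻¹' (s ×ˢ t)) = Nat.card s * Nat.card t := by
  rw [← Nat.card_prod, ← Nat.card_congr (Equiv.Set.prod s t)]
  exact Nat.card_congr (e.subtypeEquiv (fun _ => Iff.rfl))

theorem mem_combCode_iff {n : ℕ} (Ca : Set (Fin n → ZMod 2)) (Cb : Set (Fin n → ZMod 3))
    (c : Fin n → Hring) :
    c ∈ combCode Ca Cb ↔ (fun i => (c i).1) ∈ Ca ∧ (fun i => (c i).2) ∈ Cb := by
  constructor
  · rintro ⟨x, hx, y, hy, rfl⟩
    simpa [aVec, bVec] using And.intro hx hy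
  · rintro ⟨hx, hy⟩
    refine ⟨_, hx, _, hy, ?_⟩
    funext i
    simp [aVec, bVec]

theorem innerH_mul32 {n : ℕ} (x y : Fin n → Hring) :
    innerH mul32 x y = (0, innerF (fun i => (x i).2) (fun i => (y i).2)) := by
  simp only [innerH, innerF, mul32]
  ext
  · simp [Prod.fst_sum]
  · simp [Prod.snd_sum]

theorem mem_dualH_iff {n : ℕ} (Ca : Submodule (ZMod 2) (Fin n → ZMod 2))
    (Cb : Submodule (ZMod 3) (Fin n → ZMod 3)) (c : Fin n → Hring) :
    c ∈ dualH mul32 (combCode (Ca : Set (Fin n → ZMod 2)) (Cb : Set (Fin n → ZMod 3))) ↔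
      (fun i => (c i).2) ∈ dualF (Cb : Set (Fin n → ZMod 3)) := by
  constructor
  · intro h y hy
    have h1 := h (fun i => (0, y i)) ((mem_combCode_iff _ _ _).2 ⟨Ca.zero_mem, hy⟩)
    rw [innerH_mul32] at h1
    exact congrArg Prod.snd h1
  · intro h x hx
    rw [innerH_mul32, h _ ((mem_combCode_iff _ _ _).1 hx).2]
    rfl

theorem card_mul_card_dualF {n : ℕ} (Cb : Submodule (ZMod 3) (Fin n → ZMod 3)) :
    Nat.card Cb * Nat.card (dualF (Cb : Set (Fin n → ZMod 3))) = 3 ^ n := by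
  have : Fact (Nat.Prime 3) := ⟨Nat.prime_three⟩
  let e := dotProductEquiv (ZMod 3) (Fin n)
  let W := Cb.map (e : (Fin n → ZMod 3) →ₗ[ZMod 3] Module.Dual (ZMod 3) (Fin n → ZMod 3))
  have hW : (W.dualCoannihilator : Set (Fin n → ZMod 3)) = dualF (Cb : Set (Fin n → ZMod 3)) := by
    ext y
    constructor
    · intro h x hx
      exact (Submodule.mem_dualCoannihilator _).1 h (e x) (Submodule.mem_map_of_mem hx)
    · intro h
      refine (Submodule.mem_dualCoannihilator _).2 ?_
      rintro _ ⟨x, hx, rfl⟩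
      exact h x hx
  have h1 := Subspace.finrank_add_finrank_dualCoannihilator_eq W
  have h2 : Module.finrank (ZMod 3) W = Module.finrank (ZMod 3) Cb :=
    LinearEquiv.finrank_map_eq e Cb
  rw [← hW]
  change Nat.card Cb * Nat.card W.dualCoannihilator = 3 ^ n
  rw [Module.natCard_eq_pow_finrank (K := ZMod 3) (V := Cb),
    Module.natCard_eq_pow_finrank (K := ZMod 3) (V := W.dualCoannihilator), ← pow_add, ← h2, h1]
  simp

/-- A code `C = a C_a ⊕ b C_b` over `H₃₂` is LCD iff `C_a = {0}` and
`C_b` is an LCD ternary code; moreover, in that case `C` is nice (`|C|·|C^⊥| = 6^n`). -/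
theorem lcd_iff_H32 {n : ℕ}
    (Ca : Submodule (ZMod 2) (Fin n → ZMod 2)) (Cb : Submodule (ZMod 3) (Fin n → ZMod 3)) :
    (combCode (Ca : Set (Fin n → ZMod 2)) (Cb : Set (Fin n → ZMod 3)) ∩
          dualH mul32 (combCode (Ca : Set (Fin n → ZMod 2)) (Cb : Set (Fin n → ZMod 3))) =
          {0} ↔
        ((Ca : Set (Fin n → ZMod 2)) = {0} ∧
          (Cb : Set (Fin n → ZMod 3)) ∩ dualF (Cb : Set (Fin n → ZMod 3)) = {0})) ∧
      (combCode (Ca : Set (Fin n → ZMod 2)) (Cb : Set (Fin n → ZMod 3)) ∩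
          dualH mul32 (combCode (Ca : Set (Fin n → ZMod 2)) (Cb : Set (Fin n → ZMod 3))) =
          {0} →
        Nat.card (combCode (Ca : Set (Fin n → ZMod 2)) (Cb : Set (Fin n → ZMod 3))) *
          Nat.card (dualH mul32
            (combCode (Ca : Set (Fin n → ZMod 2)) (Cb : Set (Fin n → ZMod 3)))) = 6 ^ n) := by
  have key : combCode (Ca : Set (Fin n → ZMod 2)) (Cb : Set (Fin n → ZMod 3)) ∩
          dualH mul32 (combCode (Ca : Set (Fin n → ZMod 2)) (Cb : Set (Fin n → ZMod 3))) =
          {0} ↔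
        ((Ca : Set (Fin n → ZMod 2)) = {0} ∧
          (Cb : Set (Fin n → ZMod 3)) ∩ dualF (Cb : Set (Fin n → ZMod 3)) = {0}) := by
    have hz : (0 : Fin n → ZMod 3) ∈ dualF (Cb : Set (Fin n → ZMod 3)) := by
      intro x _
      simp [innerF]
    simp only [Set.eq_singleton_iff_unique_mem]
    constructor
    · rintro ⟨-, h⟩
      refine ⟨⟨Ca.zero_mem, fun x hx => ?_⟩, ⟨Cb.zero_mem, hz⟩, fun y hy => ?_⟩
      · have h1 := h (fun i => (x i, 0))
          ⟨(mem_combCode_iff _ _ _).2 ⟨hx, Cb.zero_mem⟩, (mem_dualH_iff _ _ _).2 hz⟩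
        funext i
        exact congrArg Prod.fst (congrFun h1 i)
      · have h1 := h (fun i => (0, y i))
          ⟨(mem_combCode_iff _ _ _).2 ⟨Ca.zero_mem, hy.1⟩, (mem_dualH_iff _ _ _).2 hy.2⟩
        funext i
        exact congrArg Prod.snd (congrFun h1 i)
    · rintro ⟨⟨-, ha⟩, -, hb⟩
      refine ⟨⟨(mem_combCode_iff _ _ _).2 ⟨Ca.zero_mem, Cb.zero_mem⟩,
        (mem_dualH_iff _ _ _).2 hz⟩, fun c hc => ?_⟩
      have h1 := (mem_combCode_iff _ _ _).1 hc.1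
      have h2 := ha _ h1.1
      have h3 := hb _ ⟨h1.2, (mem_dualH_iff _ _ _).1 hc.2⟩
      funext i
      exact Prod.ext (congrFun h2 i) (congrFun h3 i)
  refine ⟨key, fun h => ?_⟩
  obtain ⟨ha, -⟩ := key.1 h
  let e := Equiv.arrowProdEquivProdArrow (Fin n) (fun _ => ZMod 2) (fun _ => ZMod 3)
  have c1 : Nat.card (combCode (Ca : Set (Fin n → ZMod 2)) (Cb : Set (Fin n → ZMod 3))) =
      Nat.card Cb := by
    have h1 : combCode (Ca : Set (Fin n → ZMod 2)) (Cb : Set (Fin n → ZMod 3)) =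
        e ⁻¹' ((Ca : Set (Fin n → ZMod 2)) ×ˢ (Cb : Set (Fin n → ZMod 3))) := by
      ext c
      exact mem_combCode_iff _ _ _
    rw [h1, card_preimage_prod, ha]
    simp
  have c2 : Nat.card (dualH mul32
      (combCode (Ca : Set (Fin n → ZMod 2)) (Cb : Set (Fin n → ZMod 3)))) =
      2 ^ n * Nat.card (dualF (Cb : Set (Fin n → ZMod 3))) := by
    have h1 : dualH mul32 (combCode (Ca : Set (Fin n → ZMod 2)) (Cb : Set (Fin n → ZMod 3))) =
        e ⁻¹' ((Set.univ : Set (Fin n → ZMod 2)) ×ˢ dualF (Cb : Set (Fin n → ZMod 3))) := by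
      ext c
      rw [mem_dualH_iff]
      simp [e, Equiv.arrowProdEquivProdArrow]
    rw [h1, card_preimage_prod]
    simp
  rw [c1, c2, mul_left_comm, card_mul_card_dualF, ← mul_pow]
  norm_num
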